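/- arXiv:2012.15428 — 2 statements merged into one kernel-verified Lean document; each statement's English description precedes it below -/
import Mathlib

section
/- Joint convexity of quantum relative entropy: Let A₁, A₂, B₁, B₂ be positive definite Hermitian d×d complex matrices and t ∈ [0,1]. Then D(tA₁ + (1−t)A₂ ‖ tB₁ + (1−t)B₂) ≤ t·D(A₁‖B₁) + (1−t)·D(A₂‖B₂), where D(A‖B) := Tr(A·(log A − log B)) is the relative entropy of the positive definite matrices A and B (a real number). -/
open MeasureTheory ProbabilityTheory Matrix
open scoped ENNReal NNReal ComplexOrder

noncomputable section

/-- The σ-algebra on matrices is the entrywise (pi) one. -/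
instance matrixMeasurableSpace {k : Type*} : MeasurableSpace (Matrix k k ℂ) :=
  show MeasurableSpace (k → k → ℂ) from inferInstance

/-- Entrywise (Bochner) expectation of a matrix-valued random variable. -/
def matExpect {Ω : Type*} [MeasurableSpace Ω] (μ : Measure Ω) {k : Type*}
    (X : Ω → Matrix k k ℂ) : Matrix k k ℂ :=
  Matrix.of fun i j => ∫ ω, X ω i j ∂μ

/-- The largest eigenvalue of a Hermitian matrix (junk value `0` otherwise). -/
def maxEig {k : Type*} [Fintype k] [DecidableEq k] (A : Matrix k k ℂ) : ℝ :=
  if h : A.IsHermitian then ⨆ i, h.eigenvalues i else 0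

/-- The smallest eigenvalue of a Hermitian matrix (junk value `0` otherwise). -/
def minEig {k : Type*} [Fintype k] [DecidableEq k] (A : Matrix k k ℂ) : ℝ :=
  if h : A.IsHermitian then ⨅ i, h.eigenvalues i else 0

/-- The spectral norm (largest singular value) of a Hermitian matrix, i.e. the largest
absolute value of an eigenvalue (junk value `0` otherwise). -/
def specNorm {k : Type*} [Fintype k] [DecidableEq k] (A : Matrix k k ℂ) : ℝ :=
  if h : A.IsHermitian then ⨆ i, |h.eigenvalues i| else 0

/-- The matrix logarithm of a positive definite Hermitian matrix, obtained by applying the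
real logarithm to the eigenvalues in a spectral decomposition (junk value `0` otherwise). -/
def matLog {k : Type*} [Fintype k] [DecidableEq k] (A : Matrix k k ℂ) : Matrix k k ℂ :=
  if h : A.IsHermitian then h.cfc Real.log else 0

/-- The quantum relative entropy `D(A‖B) = Tr (A (log A − log B))` of two positive definite
Hermitian matrices, as a real number. -/
def relEntropy {k : Type*} [Fintype k] [DecidableEq k] (A B : Matrix k k ℂ) : ℝ :=
  (Matrix.trace (A * (matLog A - matLog B))).re

theorem re_scalar_id (x y : ℝ) (hx : 0 < x) (hy : 0 < y) :
    ∫ u in (0:ℝ)..1, u * ((x - y)^2 / ((1-u)*x + u*y)) =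
      x * Real.log x - x * Real.log y - x + y := by
  have hpos : ∀ u ∈ Set.uIcc (0:ℝ) 1, 0 < (1-u)*x + u*y := by
    intro u hu
    rw [Set.uIcc_of_le zero_le_one] at hu
    rcases hu.1.eq_or_lt with h | h
    · subst h; simpa using hx
    · have := mul_pos h hy
      have := mul_nonneg (sub_nonneg.2 hu.2) hx.le
      linarith
  have := intervalIntegral.integral_eq_sub_of_hasDerivAt (a := 0) (b := 1)
    (f := fun u => ((1-u)*x + u*y) - x * Real.log ((1-u)*x + u*y))
    (f' := fun u => u * ((x - y)^2 / ((1-u)*x + u*y))) ?_ ?_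
  · rw [this]; simp; ring
  · intro u hu
    have h0 := hpos u hu
    have h1 : HasDerivAt (fun u : ℝ => (1-u)*x + u*y) (y - x) u := by
      have := (((hasDerivAt_id' u).const_sub 1).mul_const x).add ((hasDerivAt_id' u).mul_const y)
      exact this.congr_deriv (by ring)
    have h2 := h1.sub ((h1.log h0.ne').const_mul x)
    refine h2.congr_deriv ?_
    have h3 := h0.ne'
    rw [← mul_div_assoc, ← mul_div_assoc, sub_div' h3]
    congr 1
    ring
  · apply ContinuousOn.intervalIntegrable
    apply continuousOn_id.mul
    apply ContinuousOn.div (by fun_prop) (by fun_prop)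
    intro u hu
    exact (hpos u hu).ne'

theorem ii_sum {ι : Type*} (s : Finset ι) (f : ι → ℝ → ℝ)
    (h : ∀ i ∈ s, IntervalIntegrable (f i) volume 0 1) :
    IntervalIntegrable (fun u => ∑ i ∈ s, f i u) volume 0 1 := by
  have e : (fun u => ∑ i ∈ s, f i u) = ∑ i ∈ s, f i := by
    funext u
    simp
  rw [e]
  exact IntervalIntegrable.sum s h

theorem re_scalar_int (x y : ℝ) (hx : 0 < x) (hy : 0 < y) :
    IntervalIntegrable (fun u : ℝ => u * ((x - y)^2 / ((1-u)*x + u*y))) volume 0 1 := by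
  apply ContinuousOn.intervalIntegrable
  apply continuousOn_id.mul
  apply ContinuousOn.div (by fun_prop) (by fun_prop)
  intro u hu
  rw [Set.uIcc_of_le zero_le_one] at hu
  rcases hu.1.eq_or_lt with h | h
  · subst h; simpa using hx.ne'
  · have := mul_pos h hy
    have := mul_nonneg (sub_nonneg.2 hu.2) hx.le
    linarith

section
variable {n : Type*} [Fintype n] [DecidableEq n]

def reQ (u : ℝ) (A B Z : Matrix n n ℂ) : ℝ :=
  2 * (Matrix.trace (Zᴴ * (A - B))).re - (1-u) * (Matrix.trace (Zᴴ * A * Z)).re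
    - u * (Matrix.trace (Zᴴ * Z * B)).re

theorem reQ_lin (u t : ℝ) (A₁ A₂ B₁ B₂ Z : Matrix n n ℂ) :
    reQ u (t • A₁ + (1 - t) • A₂) (t • B₁ + (1 - t) • B₂) Z =
      t * reQ u A₁ B₁ Z + (1 - t) * reQ u A₂ B₂ Z := by
  simp only [reQ, Matrix.mul_sub, Matrix.mul_add, Matrix.add_mul, Matrix.mul_smul,
    Matrix.smul_mul, Matrix.trace_add, Matrix.trace_sub, Matrix.trace_smul, Complex.add_re,
    Complex.sub_re, Complex.smul_re, smul_eq_mul]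
  ring

def dg (a : n → ℝ) : Matrix n n ℂ := Matrix.diagonal (fun i => (a i : ℂ))

theorem trace_K (U V : Matrix n n ℂ) (f g : n → ℝ) :
    (Matrix.trace ((U * dg f * Uᴴ) * (V * dg g * Vᴴ))).re =
      ∑ i, ∑ j, Complex.normSq ((Uᴴ * V) i j) * (f i * g j) := by
  have : Matrix.trace ((U * dg f * Uᴴ) * (V * dg g * Vᴴ)) =
      Matrix.trace (dg f * (Uᴴ * V) * dg g * (Uᴴ * V)ᴴ) := by
    rw [Matrix.conjTranspose_mul, Matrix.conjTranspose_conjTranspose]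
    simp only [Matrix.mul_assoc]
    rw [Matrix.trace_mul_comm]
    simp only [Matrix.mul_assoc]
  rw [this, Matrix.trace, Complex.re_sum]
  refine Finset.sum_congr rfl fun i _ => ?_
  rw [Matrix.diag_apply, Matrix.mul_apply, Complex.re_sum]
  refine Finset.sum_congr rfl fun j _ => ?_
  simp only [dg, Matrix.mul_diagonal, Matrix.diagonal_mul, Matrix.conjTranspose_apply,
    Complex.normSq_apply]
  simp
  ring

theorem reQ_eq (u : ℝ) (U V Y : Matrix n n ℂ) (hU : Uᴴ * U = 1) (hV : Vᴴ * V = 1)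
    (a b : n → ℝ) :
    reQ u (U * dg a * Uᴴ) (V * dg b * Vᴴ) (U * Y * Vᴴ) =
      ∑ i, ∑ j, (2 * (a i - b j) * (star (Y i j) * (Uᴴ * V) i j).re -
        ((1-u) * a i + u * b j) * Complex.normSq (Y i j)) := by
  have e1 : Matrix.trace ((U * Y * Vᴴ)ᴴ * (U * dg a * Uᴴ - V * dg b * Vᴴ)) =
      Matrix.trace ((dg a * (Uᴴ * V) - (Uᴴ * V) * dg b) * Yᴴ) := by
    have h1 : (U * Y * Vᴴ)ᴴ * (U * dg a * Uᴴ - V * dg b * Vᴴ) =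
       V * (Yᴴ * ((Uᴴ * U) * dg a * Uᴴ - Uᴴ * V * dg b * Vᴴ)) := by
      simp [Matrix.mul_assoc, Matrix.mul_sub]
    rw [h1, hU, Matrix.trace_mul_comm, Matrix.mul_assoc, Matrix.trace_mul_comm, Matrix.sub_mul]
    simp only [Matrix.mul_assoc, hV, Matrix.one_mul, Matrix.mul_one]
  have e2 : Matrix.trace ((U * Y * Vᴴ)ᴴ * (U * dg a * Uᴴ) * (U * Y * Vᴴ)) =
      Matrix.trace (dg a * Y * Yᴴ) := by
    have h1 : (U * Y * Vᴴ)ᴴ * (U * dg a * Uᴴ) * (U * Y * Vᴴ) =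
       V * (Yᴴ * ((Uᴴ * U) * dg a * (Uᴴ * U) * Y * Vᴴ)) := by
      simp [Matrix.mul_assoc]
    rw [h1, hU, Matrix.trace_mul_comm, Matrix.mul_assoc, Matrix.trace_mul_comm]
    simp only [Matrix.mul_assoc, hV, Matrix.one_mul, Matrix.mul_one]
  have e3 : Matrix.trace ((U * Y * Vᴴ)ᴴ * (U * Y * Vᴴ) * (V * dg b * Vᴴ)) =
      Matrix.trace (Y * dg b * Yᴴ) := by
    have h1 : (U * Y * Vᴴ)ᴴ * (U * Y * Vᴴ) * (V * dg b * Vᴴ) =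
       V * (Yᴴ * ((Uᴴ * U) * Y * (Vᴴ * V) * dg b * Vᴴ)) := by
      simp [Matrix.mul_assoc]
    rw [h1, hU, hV, Matrix.trace_mul_comm, Matrix.mul_assoc, Matrix.trace_mul_comm]
    simp only [Matrix.mul_assoc, hV, Matrix.one_mul, Matrix.mul_one]
  rw [reQ, e1, e2, e3]
  simp only [Matrix.trace, Complex.re_sum, Matrix.diag_apply]
  rw [Finset.mul_sum, Finset.mul_sum, Finset.mul_sum, ← Finset.sum_sub_distrib,
    ← Finset.sum_sub_distrib]
  refine Finset.sum_congr rfl fun i _ => ?_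
  rw [Matrix.mul_apply, Matrix.mul_apply, Matrix.mul_apply, Complex.re_sum, Complex.re_sum,
    Complex.re_sum,
    Finset.mul_sum, Finset.mul_sum, Finset.mul_sum, ← Finset.sum_sub_distrib,
    ← Finset.sum_sub_distrib]
  refine Finset.sum_congr rfl fun j _ => ?_
  simp only [dg, Matrix.mul_diagonal, Matrix.diagonal_mul, Matrix.conjTranspose_apply,
    Complex.normSq_apply, Matrix.sub_apply]
  simp
  ring

/-- spectral data -/
structure SD (A : Matrix n n ℂ) where
  U : Matrix n n ℂ
  a : n → ℝ
  h1 : Uᴴ * U = 1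
  h2 : U * Uᴴ = 1
  hA : A = U * dg a * Uᴴ
  hlog : matLog A = U * dg (fun i => Real.log (a i)) * Uᴴ
  pos : ∀ i, 0 < a i

theorem exists_SD (A : Matrix n n ℂ) (hA : A.PosDef) : Nonempty (SD A) := by
  have h := hA.isHermitian
  refine ⟨⟨h.eigenvectorUnitary, h.eigenvalues, ?_, ?_, ?_, ?_, hA.eigenvalues_pos⟩⟩
  · exact Unitary.coe_star_mul_self h.eigenvectorUnitary
  · exact Unitary.coe_mul_star_self h.eigenvectorUnitary
  · exact h.spectral_theorem
  · rw [matLog, dif_pos h]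
    rfl

def reF (u : ℝ) {A B : Matrix n n ℂ} (S : SD A) (T : SD B) : ℝ :=
  ∑ i, ∑ j, Complex.normSq ((S.Uᴴ * T.U) i j) *
    ((S.a i - T.a j)^2 / ((1-u) * S.a i + u * T.a j))

theorem cpos (u x y : ℝ) (hu : u ∈ Set.Icc (0:ℝ) 1) (hx : 0 < x) (hy : 0 < y) :
    0 < (1-u)*x + u*y := by
  rcases hu.1.eq_or_lt with h | h
  · subst h; simpa using hx
  · have := mul_pos h hy
    have := mul_nonneg (sub_nonneg.2 hu.2) hx.le
    linarith

theorem reQ_le (u : ℝ) (hu : u ∈ Set.Icc (0:ℝ) 1) {A B : Matrix n n ℂ} (S : SD A) (T : SD B)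
    (Z : Matrix n n ℂ) : reQ u A B Z ≤ reF u S T := by
  have hZ : Z = S.U * (S.Uᴴ * Z * T.U) * T.Uᴴ := by
    have : S.U * (S.Uᴴ * Z * T.U) * T.Uᴴ = (S.U * S.Uᴴ) * Z * (T.U * T.Uᴴ) := by
      simp only [Matrix.mul_assoc]
    rw [this, S.h2, T.h2]; simp
  have h := reQ_eq u S.U T.U (S.Uᴴ * Z * T.U) S.h1 T.h1 S.a T.a
  rw [← hZ, ← S.hA, ← T.hA] at h
  rw [h, reF]
  refine Finset.sum_le_sum fun i _ => Finset.sum_le_sum fun j _ => ?_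
  have hc := cpos u _ _ hu (S.pos i) (T.pos j)
  generalize (1-u) * S.a i + u * T.a j = c at *
  generalize S.a i - T.a j = d
  generalize (S.Uᴴ * Z * T.U) i j = y
  generalize (S.Uᴴ * T.U) i j = w
  rw [← mul_div_assoc, le_div_iff₀ hc]
  simp [Complex.normSq_apply]
  nlinarith [sq_nonneg (c * y.re - d * w.re), sq_nonneg (c * y.im - d * w.im)]

theorem exists_reQ (u : ℝ) (hu : u ∈ Set.Icc (0:ℝ) 1) {A B : Matrix n n ℂ} (S : SD A) (T : SD B) :
    ∃ Z, reQ u A B Z = reF u S T := by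
  refine ⟨S.U * (Matrix.of fun i j => (((S.a i - T.a j) / ((1-u) * S.a i + u * T.a j) : ℝ) : ℂ) *
    (S.Uᴴ * T.U) i j) * T.Uᴴ, ?_⟩
  have h := fun Y => reQ_eq u S.U T.U Y S.h1 T.h1 S.a T.a
  simp only [← S.hA, ← T.hA] at h
  rw [h, reF]
  refine Finset.sum_congr rfl fun i _ => Finset.sum_congr rfl fun j _ => ?_
  have hc := cpos u _ _ hu (S.pos i) (T.pos j)
  rw [Matrix.of_apply]
  generalize (1-u) * S.a i + u * T.a j = c at *
  generalize S.a i - T.a j = d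
  generalize (S.Uᴴ * T.U) i j = w
  have e : (star (((d / c : ℝ) : ℂ) * w) * w).re = d / c * Complex.normSq w := by
    simp only [star_mul', Complex.star_def, Complex.conj_ofReal, mul_assoc, Complex.re_ofReal_mul]
    simp [Complex.normSq_apply]
  rw [e, Complex.normSq_mul, Complex.normSq_ofReal]
  field_simp
  ring

theorem relEntropy_eq {A B : Matrix n n ℂ} (S : SD A) (T : SD B) :
    relEntropy A B = ((Matrix.trace A).re - (Matrix.trace B).re) +
      ∫ u in (0:ℝ)..1, u * reF u S T := by
  have hone : ∀ {C : Matrix n n ℂ} (R : SD C), R.U * dg (fun _ => 1) * R.Uᴴ = 1 := by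
    intro C R
    have : dg (fun _ : n => (1:ℝ)) = 1 := by simp [dg]
    rw [this, Matrix.mul_one, R.h2]
  have hAA : A * matLog A = (S.U * dg (fun i => S.a i * Real.log (S.a i)) * S.Uᴴ) *
      (T.U * dg (fun _ => 1) * T.Uᴴ) := by
    rw [hone, Matrix.mul_one, S.hlog]
    nth_rw 1 [S.hA]
    have : S.U * dg S.a * S.Uᴴ * (S.U * dg (fun i => Real.log (S.a i)) * S.Uᴴ) =
      S.U * dg S.a * (S.Uᴴ * S.U) * (dg (fun i => Real.log (S.a i)) * S.Uᴴ) := by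
      simp only [Matrix.mul_assoc]
    rw [this, S.h1, Matrix.mul_one, ← Matrix.mul_assoc, Matrix.mul_assoc S.U]
    simp [dg]
  have hAB : A * matLog B = (S.U * dg S.a * S.Uᴴ) *
      (T.U * dg (fun j => Real.log (T.a j)) * T.Uᴴ) := by
    rw [T.hlog, ← S.hA]
  have hA1 : A = (S.U * dg S.a * S.Uᴴ) * (T.U * dg (fun _ => 1) * T.Uᴴ) := by
    rw [hone, Matrix.mul_one, ← S.hA]
  have hB1 : B = (S.U * dg (fun _ => 1) * S.Uᴴ) * (T.U * dg T.a * T.Uᴴ) := by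
    rw [hone, Matrix.one_mul, ← T.hA]
  have tA : (Matrix.trace A).re = _ := (congrArg (fun M => (Matrix.trace M).re) hA1).trans
    (trace_K _ _ _ _)
  have tB : (Matrix.trace B).re = _ := (congrArg (fun M => (Matrix.trace M).re) hB1).trans
    (trace_K _ _ _ _)
  have hint : ∫ u in (0:ℝ)..1, u * reF u S T = ∑ i, ∑ j, Complex.normSq ((S.Uᴴ * T.U) i j) *
      (S.a i * Real.log (S.a i) - S.a i * Real.log (T.a j) - S.a i + T.a j) := by
    have : ∀ u, u * reF u S T = ∑ i, ∑ j, Complex.normSq ((S.Uᴴ * T.U) i j) *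
        (u * ((S.a i - T.a j)^2 / ((1-u) * S.a i + u * T.a j))) := by
      intro u
      simp only [reF, Finset.mul_sum]
      refine Finset.sum_congr rfl fun i _ => Finset.sum_congr rfl fun j _ => ?_
      ring
    simp only [this]
    rw [intervalIntegral.integral_finsetSum]
    · refine Finset.sum_congr rfl fun i _ => ?_
      rw [intervalIntegral.integral_finsetSum]
      · refine Finset.sum_congr rfl fun j _ => ?_
        rw [intervalIntegral.integral_const_mul, re_scalar_id _ _ (S.pos i) (T.pos j)]
      · intro j _
        exact (re_scalar_int _ _ (S.pos i) (T.pos j)).const_mul _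
    · intro i _
      apply ii_sum
      intro j _
      exact (re_scalar_int _ _ (S.pos i) (T.pos j)).const_mul _
  rw [hint, tA, tB, relEntropy, Matrix.mul_sub, Matrix.trace_sub, Complex.sub_re, hAA, hAB,
    trace_K, trace_K]
  simp only [← Finset.sum_sub_distrib, ← Finset.sum_add_distrib]
  refine Finset.sum_congr rfl fun i _ => Finset.sum_congr rfl fun j _ => ?_
  ring

theorem reF_int {A B : Matrix n n ℂ} (S : SD A) (T : SD B) :
    IntervalIntegrable (fun u => u * reF u S T) volume 0 1 := by
  have : (fun u => u * reF u S T) = fun u => ∑ i, ∑ j, Complex.normSq ((S.Uᴴ * T.U) i j) *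
      (u * ((S.a i - T.a j)^2 / ((1-u) * S.a i + u * T.a j))) := by
    funext u
    simp only [reF, Finset.mul_sum]
    refine Finset.sum_congr rfl fun i _ => Finset.sum_congr rfl fun j _ => ?_
    ring
  rw [this]
  apply ii_sum
  intro i _
  apply ii_sum
  intro j _
  exact (re_scalar_int _ _ (S.pos i) (T.pos j)).const_mul _

theorem posDef_comb (A B : Matrix n n ℂ) (hA : A.PosDef) (hB : B.PosDef) (t : ℝ)
    (ht : t ∈ Set.Icc (0 : ℝ) 1) : (t • A + (1 - t) • B).PosDef := by
  rcases ht.1.eq_or_lt with h | h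
  · subst h; simpa using hB
  rcases ht.2.eq_or_lt with h' | h'
  · subst h'; simpa using hA
  · exact (hA.smul h).add (hB.smul (sub_pos.2 h'))

end

/-- **Joint convexity of quantum relative entropy.** -/
theorem relEntropy_joint_convexity
    {n : Type*} [Fintype n] [DecidableEq n] [Nonempty n]
    (A₁ A₂ B₁ B₂ : Matrix n n ℂ)
    (hA₁ : A₁.PosDef) (hA₂ : A₂.PosDef) (hB₁ : B₁.PosDef) (hB₂ : B₂.PosDef)
    (t : ℝ) (ht : t ∈ Set.Icc (0 : ℝ) 1) :
    relEntropy (t • A₁ + (1 - t) • A₂) (t • B₁ + (1 - t) • B₂) ≤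
      t * relEntropy A₁ B₁ + (1 - t) * relEntropy A₂ B₂ := by
  obtain ⟨S₁⟩ := exists_SD A₁ hA₁
  obtain ⟨S₂⟩ := exists_SD A₂ hA₂
  obtain ⟨T₁⟩ := exists_SD B₁ hB₁
  obtain ⟨T₂⟩ := exists_SD B₂ hB₂
  obtain ⟨S⟩ := exists_SD _ (posDef_comb A₁ A₂ hA₁ hA₂ t ht)
  obtain ⟨T⟩ := exists_SD _ (posDef_comb B₁ B₂ hB₁ hB₂ t ht)
  rw [relEntropy_eq S T, relEntropy_eq S₁ T₁, relEntropy_eq S₂ T₂]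
  have key : ∫ u in (0:ℝ)..1, u * reF u S T ≤
      ∫ u in (0:ℝ)..1, (t * (u * reF u S₁ T₁) + (1 - t) * (u * reF u S₂ T₂)) := by
    apply intervalIntegral.integral_mono_on zero_le_one (reF_int S T)
      (((reF_int S₁ T₁).const_mul t).add ((reF_int S₂ T₂).const_mul (1 - t)))
    intro u hu
    obtain ⟨Z, hZ⟩ := exists_reQ u hu S T
    rw [← hZ, reQ_lin]
    have h1 := mul_le_mul_of_nonneg_left (reQ_le u hu S₁ T₁ Z) (mul_nonneg hu.1 ht.1)
    have h2 := mul_le_mul_of_nonneg_left (reQ_le u hu S₂ T₂ Z)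
      (mul_nonneg hu.1 (sub_nonneg.2 ht.2))
    linarith
  rw [intervalIntegral.integral_add ((reF_int S₁ T₁).const_mul t)
    ((reF_int S₂ T₂).const_mul (1 - t)), intervalIntegral.integral_const_mul,
    intervalIntegral.integral_const_mul] at key
  simp only [Matrix.trace_add, Matrix.trace_smul, Complex.add_re, Complex.smul_re, smul_eq_mul]
  linarith

end
end

section
/- Matrix Azuma inequality: Let (𝔉ᵢ)_{i=0}^n be a filtration on a probability space (Ω, 𝔉, ℙ), let X₁, …, Xₙ be random Hermitian d×d complex matrices with each Xᵢ measurable with respect to 𝔉ᵢ, and let A₁, …, Aₙ be fixed Hermitian matrices such that the conditional expectation 𝔼[Xᵢ | 𝔉_{i−1}] = 0 almost surely and Xᵢ² ⪯ Aᵢ² almost surely, for each i. Set σ² := ‖Σ_{i=1}^n Aᵢ²‖, assumed positive. Then for all θ ≥ 0, ℙ(λ_max(Σ_{i=1}^n Xᵢ) ≥ θ) ≤ d·e^{−θ²/(8σ²)}. -/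
open MeasureTheory ProbabilityTheory Matrix
open scoped ENNReal NNReal ComplexOrder

noncomputable section

section helpers
set_option linter.unusedSectionVars false
variable {n : Type*} [Fintype n] [DecidableEq n]

def spF (U : Matrix n n ℂ) (a : n → ℝ) (f : ℝ → ℝ) : Matrix n n ℂ :=
  U * diagonal (fun i => ((f (a i) : ℝ) : ℂ)) * Uᴴ

lemma spF_exists {A : Matrix n n ℂ} (hA : A.IsHermitian) :
    ∃ (U : Matrix n n ℂ) (a : n → ℝ), Uᴴ * U = 1 ∧ U * Uᴴ = 1 ∧ A = spF U a id ∧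
      a = hA.eigenvalues := by
  refine ⟨hA.eigenvectorUnitary, hA.eigenvalues, ?_, ?_, ?_, rfl⟩
  · exact Unitary.coe_star_mul_self _
  · exact Unitary.coe_mul_star_self _
  · conv_lhs => rw [hA.spectral_theorem]
    rfl

lemma spF_mul {U : Matrix n n ℂ} (hU : Uᴴ * U = 1) (a : n → ℝ) (f g : ℝ → ℝ) :
    spF U a f * spF U a g = spF U a (fun x => f x * g x) := by
  unfold spF
  calc _ = U * diagonal (fun i => ((f (a i) : ℝ) : ℂ)) * (Uᴴ * U)
        * diagonal (fun i => ((g (a i) : ℝ) : ℂ)) * Uᴴ := by simp only [Matrix.mul_assoc]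
    _ = _ := by
      rw [hU, Matrix.mul_one, Matrix.mul_assoc U, diagonal_mul_diagonal]
      simp

lemma spF_one {U : Matrix n n ℂ} (hU : U * Uᴴ = 1) (a : n → ℝ) :
    spF U a (fun _ => 1) = 1 := by
  simp [spF, hU]

lemma spF_exp {U : Matrix n n ℂ} (hU : Uᴴ * U = 1) (hU' : U * Uᴴ = 1) (a : n → ℝ) :
    NormedSpace.exp (spF U a id) = spF U a Real.exp := by
  have hi : U⁻¹ = Uᴴ := Matrix.inv_eq_left_inv hU
  unfold spF
  rw [← hi, Matrix.exp_conj _ _ (IsUnit.of_mul_eq_one _ hU'), Matrix.exp_diagonal]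
  congr 3
  ext i
  rw [Pi.coe_exp]
  simp [Complex.exp_eq_exp_ℂ]

lemma spF_trace (U V : Matrix n n ℂ) (a b : n → ℝ) (f g : ℝ → ℝ) :
    (spF U a f * spF V b g).trace.re =
      ∑ i, ∑ j, Complex.normSq ((Uᴴ * V) i j) * (f (a i) * g (b j)) := by
  have : (spF U a f * spF V b g).trace =
      (diagonal (fun i => ((f (a i) : ℝ) : ℂ)) * (Uᴴ * V) *
        diagonal (fun i => ((g (b i) : ℝ) : ℂ)) * (Uᴴ * V)ᴴ).trace := by
    unfold spF
    rw [conjTranspose_mul, conjTranspose_conjTranspose]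
    simp only [Matrix.mul_assoc]
    rw [Matrix.trace_mul_comm]
    simp only [Matrix.mul_assoc]
  rw [this]
  generalize Uᴴ * V = W
  simp only [trace, diag, Matrix.mul_apply (N := Wᴴ), Matrix.mul_diagonal, Matrix.diagonal_mul,
    Complex.re_sum, conjTranspose_apply]
  refine Finset.sum_congr rfl fun i _ => Finset.sum_congr rfl fun j _ => ?_
  simp [Complex.normSq_apply]
  ring

/-- trace exponential -/
def trE (A : Matrix n n ℂ) : ℝ := (NormedSpace.exp A).trace.re

def rt (A : Matrix n n ℂ) : ℝ := A.trace.re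

lemma rt_add (A B : Matrix n n ℂ) : rt (A + B) = rt A + rt B := by simp [rt]
lemma rt_sub (A B : Matrix n n ℂ) : rt (A - B) = rt A - rt B := by simp [rt]
lemma rt_smul (c : ℝ) (A : Matrix n n ℂ) : rt (c • A) = c * rt A := by simp [rt]

lemma trE_klein {A B : Matrix n n ℂ} (hA : A.IsHermitian) (hB : B.IsHermitian) :
    trE A + rt ((B - A) * NormedSpace.exp A) ≤ trE B := by
  obtain ⟨U, a, hU, hU', rfl, -⟩ := spF_exists hA
  obtain ⟨V, b, hV, hV', rfl, -⟩ := spF_exists hB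
  have h1 : trE (spF U a id) = (spF U a Real.exp * spF V b (fun _ => 1)).trace.re := by
    rw [spF_one hV', Matrix.mul_one, trE, spF_exp hU hU']
  have h2 : trE (spF V b id) = (spF U a (fun _ => 1) * spF V b Real.exp).trace.re := by
    rw [spF_one hU', Matrix.one_mul, trE, spF_exp hV hV']
  have h3 : rt ((spF V b id - spF U a id) * NormedSpace.exp (spF U a id)) =
      (spF U a Real.exp * spF V b id).trace.re
       - (spF U a (fun x => x * Real.exp x) * spF V b (fun _ => 1)).trace.re := by
    rw [spF_one hV', Matrix.mul_one, spF_exp hU hU', Matrix.sub_mul, rt_sub, spF_mul hU,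
      rt, Matrix.trace_mul_comm]
    rfl
  rw [h1, h2, h3]
  simp only [spF_trace, ← Finset.sum_sub_distrib, ← Finset.sum_add_distrib]
  refine Finset.sum_le_sum fun i _ => Finset.sum_le_sum fun j _ => ?_
  have hw := Complex.normSq_nonneg ((Uᴴ * V) i j)
  generalize Complex.normSq ((Uᴴ * V) i j) = w at *
  have : Real.exp (a i) * (1 + (b j - a i)) ≤ Real.exp (b j) := by
    have := mul_le_mul_of_nonneg_left (Real.add_one_le_exp (b j - a i)) (Real.exp_pos (a i)).le
    rw [← Real.exp_add] at this
    calc _ = Real.exp (a i) * (b j - a i + 1) := by ring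
      _ ≤ _ := this
      _ = _ := by ring_nf
  have := mul_le_mul_of_nonneg_left this hw
  simp only [id]
  linarith

lemma scalar_ineq_aux {x : ℝ} (hx : 0 ≤ x) : 2 * (Real.exp x - 1) ≤ x * (Real.exp x + 1) := by
  have h : MonotoneOn (fun x : ℝ => x * (Real.exp x + 1) - 2 * (Real.exp x - 1)) (Set.Ici 0) := by
    apply monotoneOn_of_deriv_nonneg (convex_Ici 0)
    · fun_prop
    · fun_prop
    · intro y hy
      have : HasDerivAt (fun x : ℝ => x * (Real.exp x + 1) - 2 * (Real.exp x - 1))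
        (1 * (Real.exp y + 1) + y * Real.exp y - 2 * Real.exp y) y :=
        ((hasDerivAt_id y).mul ((Real.hasDerivAt_exp y).add_const 1)).sub
          (((Real.hasDerivAt_exp y).sub_const 1).const_mul 2)
      rw [this.deriv]
      have h1 := Real.add_one_le_exp (-y)
      have h2 := mul_le_mul_of_nonneg_left h1 (Real.exp_pos y).le
      rw [← Real.exp_add] at h2
      simp at h2
      linarith
  have := h (Set.mem_Ici.2 le_rfl) (Set.mem_Ici.2 hx) hx
  simp at this
  linarith

lemma scalar_ineq (p q : ℝ) : (p - q) * (Real.exp p - Real.exp q) ≤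
    1 / 2 * ((p - q) ^ 2 * (Real.exp p + Real.exp q)) := by
  wlog h : q ≤ p generalizing p q
  · have := this q p (by linarith)
    linarith
  have h1 := scalar_ineq_aux (sub_nonneg.2 h)
  have h2 := mul_le_mul_of_nonneg_left h1 (mul_nonneg (sub_nonneg.2 h) (Real.exp_pos q).le)
  have h3 : Real.exp p = Real.exp q * Real.exp (p - q) := by rw [← Real.exp_add]; ring_nf
  rw [h3]
  linarith

lemma trE_klein2 {P Q : Matrix n n ℂ} (hP : P.IsHermitian) (hQ : Q.IsHermitian) :
    rt ((P - Q) * (NormedSpace.exp P - NormedSpace.exp Q)) ≤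
      1 / 2 * rt ((P - Q) ^ 2 * (NormedSpace.exp P + NormedSpace.exp Q)) := by
  obtain ⟨U, a, hU, hU', rfl, -⟩ := spF_exists hP
  obtain ⟨V, b, hV, hV', rfl, -⟩ := spF_exists hQ
  rw [spF_exp hU hU', spF_exp hV hV']
  have h3 : rt ((spF U a id - spF V b id) * (spF U a Real.exp - spF V b Real.exp)) =
      (spF U a (fun x => x * Real.exp x) * spF V b (fun _ => 1)).trace.re
      - (spF U a id * spF V b Real.exp).trace.re
      - (spF U a Real.exp * spF V b id).trace.re
      + (spF U a (fun _ => 1) * spF V b (fun x => x * Real.exp x)).trace.re := by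
    rw [spF_one hV', spF_one hU', Matrix.mul_one, Matrix.one_mul,
      Matrix.trace_mul_comm (spF U a Real.exp),
      ← spF_mul hU a (fun x => x) Real.exp, ← spF_mul hV b (fun x => x) Real.exp]
    simp only [Matrix.sub_mul, Matrix.mul_sub, rt_sub]
    simp only [rt]
    change _ = (spF U a id * _).trace.re - _ - _ + (spF V b id * _).trace.re
    ring
  have h4 : rt ((spF U a id - spF V b id) ^ 2 * (spF U a Real.exp + spF V b Real.exp)) =
      (spF U a (fun x => x * x * Real.exp x) * spF V b (fun _ => 1)).trace.re
      - 2 * (spF U a (fun x => x * Real.exp x) * spF V b id).trace.re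
      + (spF U a Real.exp * spF V b (fun x => x * x)).trace.re
      + (spF U a (fun _ => 1) * spF V b (fun x => x * x * Real.exp x)).trace.re
      - 2 * (spF U a id * spF V b (fun x => x * Real.exp x)).trace.re
      + (spF U a (fun x => x * x) * spF V b Real.exp).trace.re := by
    have cU : spF U a Real.exp * spF U a id = spF U a id * spF U a Real.exp := by
      rw [spF_mul hU, spF_mul hU]; congr 1; ext x; simp [mul_comm]
    have cV : spF V b Real.exp * spF V b id = spF V b id * spF V b Real.exp := by
      rw [spF_mul hV, spF_mul hV]; congr 1; ext x; simp [mul_comm]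
    rw [spF_one hV', spF_one hU', Matrix.mul_one, Matrix.one_mul,
      ← spF_mul hU a (fun x => x * x) Real.exp, ← spF_mul hV b (fun x => x * x) Real.exp,
      ← spF_mul hU a (fun x => x) Real.exp, ← spF_mul hV b (fun x => x) Real.exp,
      ← spF_mul hU a (fun x => x) (fun x => x), ← spF_mul hV b (fun x => x) (fun x => x)]
    change _ = (spF U a id * spF U a id * _).trace.re - 2 * ((spF U a id * _) * _).trace.re
      + (_ * (spF V b id * spF V b id)).trace.re + (spF V b id * spF V b id * _).trace.re
      - 2 * (_ * (spF V b id * _)).trace.re + (spF U a id * spF U a id * _).trace.re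
    generalize spF U a id = P at *
    generalize spF V b id = Q at *
    generalize spF U a Real.exp = E at *
    generalize spF V b Real.exp = G at *
    have e1 : (P * Q * E).trace = (P * E * Q).trace := by
      rw [Matrix.trace_mul_comm, ← Matrix.mul_assoc, cU]
    have e2 : (Q * P * E).trace = (P * E * Q).trace := by
      rw [Matrix.mul_assoc, Matrix.trace_mul_comm]
    have e3 : (Q * Q * E).trace = (E * (Q * Q)).trace := Matrix.trace_mul_comm _ _
    have e4 : (P * Q * G).trace = (P * (Q * G)).trace := by rw [Matrix.mul_assoc]
    have e5 : (Q * P * G).trace = (P * (Q * G)).trace := by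
      rw [Matrix.mul_assoc, Matrix.trace_mul_comm, Matrix.mul_assoc, cV]
    rw [pow_two]
    simp only [Matrix.sub_mul, Matrix.mul_sub, Matrix.mul_add, rt_sub, rt_add]
    simp only [rt, e1, e2, e3, e4, e5]
    ring
  rw [h3, h4]
  simp only [spF_trace, Finset.mul_sum, ← Finset.sum_sub_distrib, ← Finset.sum_add_distrib]
  refine Finset.sum_le_sum fun i _ => Finset.sum_le_sum fun j _ => ?_
  have hw := Complex.normSq_nonneg ((Uᴴ * V) i j)
  generalize Complex.normSq ((Uᴴ * V) i j) = w at *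
  have := mul_le_mul_of_nonneg_left (scalar_ineq (a i) (b j)) hw
  simp only [id]
  linarith

lemma rt_mul_nonneg {A B : Matrix n n ℂ} (hA : A.IsHermitian) (hB : B.PosSemidef) :
    0 ≤ rt (B * NormedSpace.exp A) := by
  obtain ⟨U, a, hU, hU', rfl, -⟩ := spF_exists hA
  obtain ⟨V, b, hV, hV', rfl, hb⟩ := spF_exists hB.isHermitian
  rw [spF_exp hU hU', rt, spF_trace]
  refine Finset.sum_nonneg fun i _ => Finset.sum_nonneg fun j _ => ?_
  have := hB.eigenvalues_nonneg i
  rw [← hb] at this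
  exact mul_nonneg (Complex.normSq_nonneg _) (mul_nonneg this (Real.exp_pos _).le)

lemma trE_mono {A B : Matrix n n ℂ} (hA : A.IsHermitian) (hB : B.IsHermitian)
    (h : (B - A).PosSemidef) : trE A ≤ trE B := by
  have := trE_klein hA hB
  have := rt_mul_nonneg hA h
  linarith

lemma continuous_mexp : Continuous (fun A : Matrix n n ℂ => NormedSpace.exp A) := by
  let : NormedRing (Matrix n n ℂ) := Matrix.linftyOpNormedRing
  let : NormedAlgebra ℂ (Matrix n n ℂ) := Matrix.linftyOpNormedAlgebra
  let : NormedAlgebra ℚ (Matrix n n ℂ) := NormedAlgebra.restrictScalars ℚ ℂ _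
  exact NormedSpace.exp_continuous

lemma continuous_trE : Continuous (trE : Matrix n n ℂ → ℝ) :=
  Complex.continuous_re.comp continuous_mexp.matrix_trace

lemma continuous_rt : Continuous (rt : Matrix n n ℂ → ℝ) :=
  Complex.continuous_re.comp continuous_id.matrix_trace

lemma trE_key {H Y : Matrix n n ℂ} (hH : H.IsHermitian) (hY : Y.IsHermitian) :
    1 / 2 * (trE (H + Y) + trE (H - Y)) ≤ trE (H + (1 / 2 : ℝ) • Y ^ 2) := by
  set P : ℝ → Matrix n n ℂ := fun s => H + s • Y + ((1 - s ^ 2) / 2) • Y ^ 2 with hPdef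
  have hPh : ∀ s, (P s).IsHermitian := fun s =>
    (hH.add (hY.smul (IsSelfAdjoint.all s))).add ((hY.pow 2).smul (IsSelfAdjoint.all _))
  have hPc : Continuous P := by fun_prop
  set R : ℝ → ℝ := fun t =>
    rt (Y ^ 2 * (NormedSpace.exp (P t) + NormedSpace.exp (P (-t)))) with hR
  have hRc : Continuous R := by
    refine continuous_rt.comp ((continuous_const).mul ?_)
    exact (continuous_mexp.comp hPc).add (continuous_mexp.comp (hPc.comp continuous_neg))
  obtain ⟨C, hC⟩ := (isCompact_Icc (a := (0:ℝ)) (b := 1)).bddAbove_image hRc.continuousOn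
  have hC' : ∀ t ∈ Set.Icc (0:ℝ) 1, R t ≤ C := fun t ht => hC ⟨t, ht, rfl⟩
  set ψ : ℝ → ℝ := fun s => trE (P s) + trE (P (-s)) with hψ
  have step : ∀ s t : ℝ, 0 ≤ s → s < t → t ≤ 1 → ψ t - ψ s ≤ 1 / 2 * (t - s) ^ 2 * C := by
    intro s t hs hst ht
    have k1 := trE_klein (hPh t) (hPh s)
    have k2 := trE_klein (hPh (-t)) (hPh (-s))
    have k3 := trE_klein2 (hPh t) (hPh (-t))
    have d1 : P s - P t = (s - t) • Y + ((t ^ 2 - s ^ 2) / 2) • Y ^ 2 := by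
      simp only [hPdef]; module
    have d2 : P (-s) - P (-t) = (-(s - t)) • Y + ((t ^ 2 - s ^ 2) / 2) • Y ^ 2 := by
      simp only [hPdef, neg_sq]; module
    have d3 : P t - P (-t) = (2 * t) • Y := by
      simp only [hPdef, neg_sq]; module
    rw [d1, Matrix.add_mul, rt_add, Matrix.smul_mul, Matrix.smul_mul, rt_smul, rt_smul] at k1
    rw [d2, Matrix.add_mul, rt_add, Matrix.smul_mul, Matrix.smul_mul, rt_smul, rt_smul] at k2
    rw [d3, smul_pow, Matrix.smul_mul, Matrix.smul_mul, rt_smul, rt_smul, Matrix.mul_sub,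
      rt_sub] at k3
    have hRt : R t = rt (Y ^ 2 * NormedSpace.exp (P t)) + rt (Y ^ 2 * NormedSpace.exp (P (-t))) := by
      simp only [hR, Matrix.mul_add, rt_add]
    change 2 * t * _ ≤ 1 / 2 * ((2 * t) ^ 2 * R t) at k3
    have ht0 : 0 < t := by linarith
    have k4 : rt (Y * NormedSpace.exp (P t)) - rt (Y * NormedSpace.exp (P (-t))) ≤ t * R t := by
      have : 2 * t * (rt (Y * NormedSpace.exp (P t)) - rt (Y * NormedSpace.exp (P (-t)))) ≤
        2 * t * (t * R t) := by linarith
      exact le_of_mul_le_mul_left this (by linarith)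
    have k5 := mul_le_mul_of_nonneg_left k4 (sub_nonneg.2 hst.le)
    have k6 := mul_le_mul_of_nonneg_left (hC' t ⟨ht0.le, ht⟩)
      (show 0 ≤ 1 / 2 * (t - s) ^ 2 by positivity)
    have : ψ t - ψ s ≤ (t - s) * (t * R t) - (t ^ 2 - s ^ 2) / 2 * R t := by
      rw [hRt] at k5 ⊢
      simp only [hψ]
      linarith
    calc _ ≤ _ := this
      _ = 1 / 2 * (t - s) ^ 2 * R t := by ring
      _ ≤ _ := k6
  have tel : ∀ M : ℕ, 0 < M → ψ 1 - ψ 0 ≤ (1 / 2 * C) / M := by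
    intro M hM
    have hM' : (0:ℝ) < M := by exact_mod_cast hM
    have : ∀ k : ℕ, k ≤ M → ψ (k / M) - ψ 0 ≤ k * (1 / 2 * (1 / M) ^ 2 * C) := by
      intro k
      induction k with
      | zero => intro _; simp
      | succ k ih =>
        intro hk
        have h1 := ih (by omega)
        have h2 := step (k / M) ((k + 1 : ℕ) / M) (by positivity) (by gcongr; simp)
          ((div_le_one hM').2 (by exact_mod_cast hk))
        have e : ((k + 1 : ℕ) : ℝ) / M - k / M = 1 / M := by push_cast; ring
        rw [e] at h2
        push_cast at h2 ⊢
        linarith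
    have := this M le_rfl
    rw [div_self hM'.ne'] at this
    calc _ ≤ _ := this
      _ = _ := by field_simp
  have lim : ψ 1 - ψ 0 ≤ 0 := by
    refine ge_of_tendsto (tendsto_const_div_atTop_nhds_zero_nat (1 / 2 * C)) ?_
    filter_upwards [Filter.eventually_gt_atTop 0] with M hM using tel M hM
  have e1 : P 1 = H + Y := by simp [hPdef]
  have e2 : P (-1) = H - Y := by simp [hPdef, sub_eq_add_neg]
  have e3 : P 0 = H + (1 / 2 : ℝ) • Y ^ 2 := by simp [hPdef]
  simp only [hψ, neg_zero, e1, e2, e3] at lim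
  linarith

lemma trE_step {H X A : Matrix n n ℂ} (hH : H.IsHermitian) (hX : X.IsHermitian)
    (hA : A.IsHermitian) (c : ℝ) (h : (A ^ 2 - X ^ 2).PosSemidef) :
    trE (H + c • X) ≤ trE (H + (2 * c ^ 2) • A ^ 2) + c * rt (X * NormedSpace.exp H) := by
  have hs : ∀ c : ℝ, (c • X).IsHermitian := fun c => hX.smul (IsSelfAdjoint.all c)
  have k1 := trE_klein (hH.add (hs c)) (hH.add (hs (2 * c)))
  have k2 := trE_klein (hH.add (hs c)) hH
  have k3 := trE_klein hH (hH.sub (hs (2 * c)))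
  have k4 := trE_key hH (hs (2 * c))
  have k5 : trE (H + (1 / 2 : ℝ) • ((2 * c) • X) ^ 2) ≤ trE (H + (2 * c ^ 2) • A ^ 2) := by
    refine trE_mono (hH.add (((hs _).pow 2).smul (IsSelfAdjoint.all _)))
      (hH.add ((hA.pow 2).smul (IsSelfAdjoint.all _))) ?_
    have : H + (2 * c ^ 2) • A ^ 2 - (H + (1 / 2 : ℝ) • ((2 * c) • X) ^ 2) =
      (2 * c ^ 2) • (A ^ 2 - X ^ 2) := by
      rw [smul_pow]; module
    rw [this]
    exact h.smul (by positivity)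
  have d1 : H + (2 * c) • X - (H + c • X) = c • X := by module
  have d2 : H - (H + c • X) = (-c) • X := by module
  have d3 : H - (2 * c) • X - H = (-(2 * c)) • X := by module
  rw [d1, Matrix.smul_mul, rt_smul] at k1
  rw [d2, Matrix.smul_mul, rt_smul] at k2
  rw [d3, Matrix.smul_mul, rt_smul] at k3
  linarith

lemma trE_eq_sum {A : Matrix n n ℂ} (hA : A.IsHermitian) :
    trE A = ∑ i, Real.exp (hA.eigenvalues i) := by
  obtain ⟨U, a, hU, hU', h, ha⟩ := spF_exists hA
  rw [← ha, h, trE, spF_exp hU hU', spF, Matrix.trace_mul_comm, ← Matrix.mul_assoc, hU,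
    Matrix.one_mul, Matrix.trace_diagonal, Complex.re_sum]
  simp only [Complex.ofReal_re]

lemma spF_smul (U : Matrix n n ℂ) (a : n → ℝ) (c : ℝ) :
    c • spF U a id = spF U (fun i => c * a i) id := by
  have : diagonal (fun i => ((c * a i : ℝ) : ℂ)) = c • diagonal (fun i => (a i : ℂ)) := by
    ext i j
    rw [Matrix.smul_apply, diagonal_apply, diagonal_apply]
    split_ifs <;> simp
  simp only [spF, id]
  rw [this, Matrix.mul_smul, Matrix.smul_mul]

lemma exp_maxEig_le [Nonempty n] {A : Matrix n n ℂ} (hA : A.IsHermitian) {c t : ℝ} (hc : 0 ≤ c)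
    (h : t ≤ maxEig A) : Real.exp (c * t) ≤ trE (c • A) := by
  rw [maxEig, dif_pos hA] at h
  obtain ⟨i, hi⟩ := exists_eq_ciSup_of_finite (f := hA.eigenvalues)
  rw [← hi] at h
  obtain ⟨U, a, hU, hU', hs, ha⟩ := spF_exists hA
  have e : c • A = spF U (fun i => c * a i) id := by rw [hs, spF_smul]
  rw [e, trE, spF_exp hU hU', spF, Matrix.trace_mul_comm, ← Matrix.mul_assoc, hU,
    Matrix.one_mul, Matrix.trace_diagonal, Complex.re_sum]
  simp only [Complex.ofReal_re]
  rw [← ha] at h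
  calc _ ≤ Real.exp (c * a i) := Real.exp_le_exp.2 (by gcongr)
    _ ≤ _ := Finset.single_le_sum (f := fun i => Real.exp (c * a i))
        (fun j _ => (Real.exp_pos _).le) (Finset.mem_univ i)

lemma trE_le_specNorm {A : Matrix n n ℂ} (hA : A.IsHermitian) {c : ℝ} (hc : 0 ≤ c) :
    trE (c • A) ≤ Fintype.card n * Real.exp (c * specNorm A) := by
  obtain ⟨U, a, hU, hU', hs, ha⟩ := spF_exists hA
  have e : c • A = spF U (fun i => c * a i) id := by rw [hs, spF_smul]
  rw [e, trE, spF_exp hU hU', spF, Matrix.trace_mul_comm, ← Matrix.mul_assoc, hU,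
    Matrix.one_mul, Matrix.trace_diagonal, Complex.re_sum]
  simp only [Complex.ofReal_re]
  rw [specNorm, dif_pos hA, ← ha]
  calc ∑ i, Real.exp (c * a i) ≤ ∑ i : n, Real.exp (c * ⨆ i, |a i|) := by
        refine Finset.sum_le_sum fun i _ => Real.exp_le_exp.2 ?_
        gcongr
        exact (le_abs_self _).trans (le_ciSup (f := fun i => |a i|) (Set.finite_range _).bddAbove i)
    _ = _ := by simp

lemma entry_bound {A X : Matrix n n ℂ} (hX : X.IsHermitian) (h : (A ^ 2 - X ^ 2).PosSemidef)
    (a b : n) : ‖X a b‖ ^ 2 ≤ ((A ^ 2) a a).re := by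
  have h1 := (h.diag_nonneg (i := a))
  have h2 : 0 ≤ ((A ^ 2) a a).re - ((X ^ 2) a a).re := (Complex.le_def.1 h1).1
  have h3 : ((X ^ 2) a a).re = ∑ j, ‖X a j‖ ^ 2 := by
    rw [pow_two, Matrix.mul_apply, Complex.re_sum]
    refine Finset.sum_congr rfl fun j _ => ?_
    rw [← hX.apply j a, Complex.sq_norm, Complex.normSq_apply]
    simp
  have h4 := Finset.single_le_sum (f := fun j => ‖X a j‖ ^ 2)
    (fun j _ => by positivity) (Finset.mem_univ b)
  beta_reduce at h4
  linarith

section prob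
variable {Ω : Type*} {m mΩ : MeasurableSpace Ω} {μ : Measure Ω}

def MBd (μ : Measure Ω) (Y : Ω → Matrix n n ℂ) : Prop :=
  ∃ C : ℝ, ∀ᵐ ω ∂μ, ∀ a b, ‖Y ω a b‖ ≤ C

lemma MBd.sum {ι : Type*} [Fintype ι] {Y : ι → Ω → Matrix n n ℂ} (h : ∀ i, MBd μ (Y i)) :
    MBd μ (fun ω => ∑ i, Y i ω) := by
  choose C hC using h
  refine ⟨∑ i, C i, ?_⟩
  filter_upwards [ae_all_iff.2 hC] with ω hω a b
  rw [Matrix.sum_apply]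
  exact norm_sum_le_of_le _ fun i _ => hω i a b

lemma MBd.const (A : Matrix n n ℂ) : MBd μ (fun _ => A) := by
  refine ⟨∑ a, ∑ b, ‖A a b‖, Filter.Eventually.of_forall fun ω a b => ?_⟩
  calc ‖A a b‖ ≤ ∑ b, ‖A a b‖ :=
        Finset.single_le_sum (f := fun b => ‖A a b‖) (fun _ _ => norm_nonneg _) (Finset.mem_univ b)
    _ ≤ _ := Finset.single_le_sum (f := fun a => ∑ b, ‖A a b‖)
        (fun _ _ => Finset.sum_nonneg fun _ _ => norm_nonneg _) (Finset.mem_univ a)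

lemma MBd.smul {Y : Ω → Matrix n n ℂ} (h : MBd μ Y) (c : ℝ) : MBd μ (fun ω => c • Y ω) := by
  obtain ⟨C, hC⟩ := h
  refine ⟨|c| * C, ?_⟩
  filter_upwards [hC] with ω hω a b
  rw [Matrix.smul_apply, norm_smul, Real.norm_eq_abs]
  gcongr
  exact hω a b

lemma MBd.comp {E : Type*} [NormedAddCommGroup E] {Y : Ω → Matrix n n ℂ} (h : MBd μ Y)
    (f : Matrix n n ℂ → E) (hf : Continuous f) : ∃ C : ℝ, ∀ᵐ ω ∂μ, ‖f (Y ω)‖ ≤ C := by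
  obtain ⟨C, hC⟩ := h
  have hK : IsCompact (Set.pi Set.univ fun _ : n => Set.pi Set.univ fun _ : n =>
      Metric.closedBall (0:ℂ) C) :=
    isCompact_univ_pi fun _ => isCompact_univ_pi fun _ => isCompact_closedBall _ _
  obtain ⟨D, hD⟩ := IsCompact.exists_bound_of_continuousOn (f := f) hK hf.continuousOn
  refine ⟨D, ?_⟩
  filter_upwards [hC] with ω hω
  refine hD _ fun a _ b _ => ?_
  simpa using hω a b

lemma meas_comp {m : MeasurableSpace Ω} {E : Type*} [TopologicalSpace E] [MeasurableSpace E]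
    [BorelSpace E] {Y : Ω → Matrix n n ℂ}
    (hY : ∀ a b, Measurable[m] fun ω => Y ω a b) (f : Matrix n n ℂ → E) (hf : Continuous f) :
    Measurable[m] fun ω => f (Y ω) := by
  have h1 : Measurable[m] (fun ω => (fun a b => Y ω a b : n → n → ℂ)) :=
    measurable_pi_lambda _ fun a => measurable_pi_lambda _ fun b => hY a b
  have h2 : Measurable (fun A : n → n → ℂ => f (Matrix.of A)) := by
    apply Continuous.measurable
    exact hf
  exact h2.comp h1

lemma integrable_trE [IsFiniteMeasure μ] {Y : Ω → Matrix n n ℂ}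
    (hY : ∀ a b, Measurable fun ω => Y ω a b) (hb : MBd μ Y) :
    Integrable (fun ω => trE (Y ω)) μ := by
  obtain ⟨C, hC⟩ := hb.comp trE continuous_trE
  exact Integrable.of_bound (meas_comp hY trE continuous_trE).aestronglyMeasurable C hC

lemma integral_mart [IsFiniteMeasure μ] (hm : m ≤ mΩ)
    {H X : Ω → Matrix n n ℂ}
    (hH : ∀ a b, Measurable[m] fun ω => H ω a b) (hb : MBd μ H)
    (hX : ∀ a b, Integrable (fun ω => X ω a b) μ)
    (hc : ∀ a b, μ[(fun ω => X ω a b)|m] =ᵐ[μ] 0) :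
    Integrable (fun ω => rt (X ω * NormedSpace.exp (H ω))) μ ∧
      ∫ ω, rt (X ω * NormedSpace.exp (H ω)) ∂μ = 0 := by
  have hfc : ∀ a b : n, Continuous (fun A : Matrix n n ℂ => NormedSpace.exp A b a) := fun a b =>
    continuous_mexp.matrix_elem b a
  have hem : ∀ a b : n, Measurable[m] (fun ω => NormedSpace.exp (H ω) b a) := fun a b =>
    meas_comp hH (fun A : Matrix n n ℂ => NormedSpace.exp A b a) (hfc a b)
  have key : ∀ a b, Integrable (fun ω => NormedSpace.exp (H ω) b a * X ω a b) μ ∧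
      ∫ ω, NormedSpace.exp (H ω) b a * X ω a b ∂μ = 0 := by
    intro a b
    obtain ⟨C, hC⟩ := hb.comp _ (hfc a b)
    have hint : Integrable (fun ω => NormedSpace.exp (H ω) b a * X ω a b) μ :=
      (hX a b).bdd_mul ((hem a b).mono hm le_rfl).aestronglyMeasurable hC
    refine ⟨hint, ?_⟩
    have h1 := condExp_bilin_of_stronglyMeasurable_left (ContinuousLinearMap.mul ℝ ℂ)
      (hem a b).stronglyMeasurable hint (hX a b)
    simp only [ContinuousLinearMap.mul_apply'] at h1
    rw [← integral_condExp hm, integral_congr_ae h1]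
    apply integral_eq_zero_of_ae
    filter_upwards [hc a b] with ω hω
    rw [hω]; simp
  have e : (fun ω => rt (X ω * NormedSpace.exp (H ω))) =
      fun ω => (∑ a, ∑ b, NormedSpace.exp (H ω) b a * X ω a b).re := by
    ext ω
    simp only [rt, trace, diag, Matrix.mul_apply, mul_comm]
  have hI : Integrable (fun ω => ∑ a, ∑ b, NormedSpace.exp (H ω) b a * X ω a b) μ :=
    integrable_finsetSum _ fun a _ => integrable_finsetSum _ fun b _ => (key a b).1
  rw [e]
  refine ⟨hI.re, ?_⟩
  have := integral_re hI
  simp only [RCLike.re_to_complex] at this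
  rw [this, integral_finsetSum _ fun a _ => integrable_finsetSum _ fun b _ => (key a b).1]
  rw [Finset.sum_eq_zero, Complex.zero_re]
  intro a _
  rw [integral_finsetSum _ fun b _ => (key a b).1]
  exact Finset.sum_eq_zero fun b _ => (key a b).2

end prob
end helpers

theorem matrix_azuma_inequality
    {n : Type*} [Fintype n] [DecidableEq n] [Nonempty n]
    {Ω : Type*} [MeasurableSpace Ω] (μ : Measure Ω) [IsProbabilityMeasure μ]
    {N : ℕ} (F : Fin (N + 1) → MeasurableSpace Ω)
    (hFmono : Monotone F) (hFle : ∀ k, F k ≤ (inferInstance : MeasurableSpace Ω))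
    (X : Fin N → Ω → Matrix n n ℂ)
    (hXadapted : ∀ (k : Fin N) (a b : n), Measurable[F k.succ] fun ω => X k ω a b)
    (hXherm : ∀ k, ∀ᵐ ω ∂μ, (X k ω).IsHermitian)
    (hXint : ∀ (k : Fin N) (a b : n), Integrable (fun ω => X k ω a b) μ)
    (hcond : ∀ (k : Fin N) (a b : n),
      μ[(fun ω => X k ω a b)|F k.castSucc] =ᵐ[μ] 0)
    (A : Fin N → Matrix n n ℂ) (hA : ∀ k, (A k).IsHermitian)
    (hdom : ∀ k, ∀ᵐ ω ∂μ, (A k ^ 2 - X k ω ^ 2).PosSemidef)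
    (σ2 : ℝ) (hσ2 : σ2 = specNorm (∑ i, A i ^ 2)) (hσpos : 0 < σ2)
    (θ : ℝ) (hθ : 0 ≤ θ) :
    μ {ω | θ ≤ maxEig (∑ i, X i ω)} ≤
      ENNReal.ofReal ((Fintype.card n : ℝ) * Real.exp (-θ ^ 2 / (8 * σ2))) := by
  set c : ℝ := θ / (4 * σ2) with hc
  have hc0 : 0 ≤ c := by positivity
  have hXm : ∀ (k : Fin N) (a b : n), Measurable fun ω => X k ω a b := fun k a b =>
    (hXadapted k a b).mono (hFle _) le_rfl
  have hXb : ∀ k, MBd μ (X k) := by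
    intro k
    refine ⟨∑ a, Real.sqrt ((A k ^ 2) a a).re, ?_⟩
    filter_upwards [hXherm k, hdom k] with ω h1 h2 a b
    calc ‖X k ω a b‖ ≤ Real.sqrt ((A k ^ 2) a a).re := Real.le_sqrt_of_sq_le (entry_bound h1 h2 a b)
      _ ≤ _ := Finset.single_le_sum (f := fun a => Real.sqrt ((A k ^ 2) a a).re)
        (fun _ _ => Real.sqrt_nonneg _) (Finset.mem_univ a)
  set B : ℕ → Ω → Matrix n n ℂ := fun k ω =>
    ∑ i : Fin N, if i.val < k then c • X i ω else (2 * c ^ 2) • A i ^ 2 with hB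
  have hBm : ∀ k a b, Measurable fun ω => B k ω a b := by
    intro k a b
    simp only [hB, Matrix.sum_apply]
    refine Finset.measurable_sum _ fun i _ => ?_
    split_ifs
    · simp only [Matrix.smul_apply]
      exact (hXm i a b).const_smul c
    · exact measurable_const
  have hBb : ∀ k, MBd μ (B k) := by
    intro k
    refine MBd.sum fun i => ?_
    split_ifs
    · exact (hXb i).smul c
    · exact MBd.const _
  have hstep : ∀ k : Fin N, ∫ ω, trE (B (k.val + 1) ω) ∂μ ≤ ∫ ω, trE (B k.val ω) ∂μ := by
    intro k
    set H : Ω → Matrix n n ℂ := fun ω => ∑ i : Fin N,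
      if i.val < k.val then c • X i ω else if i = k then 0 else (2 * c ^ 2) • A i ^ 2 with hH
    have hHm : ∀ a b, Measurable[F k.castSucc] fun ω => H ω a b := by
      intro a b
      simp only [hH, Matrix.sum_apply]
      refine Finset.measurable_sum _ fun i _ => ?_
      split_ifs with h1 h2
      · simp only [Matrix.smul_apply]
        refine Measurable.const_smul ((hXadapted i a b).mono (hFmono ?_) le_rfl) c
        rw [Fin.le_def]
        simpa using h1
      · exact measurable_const
      · exact measurable_const
    have hHb : MBd μ H := by
      refine MBd.sum fun i => ?_
      split_ifs
      · exact (hXb i).smul c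
      · exact MBd.const _
      · exact MBd.const _
    have e1 : ∀ ω, B (k.val + 1) ω = H ω + c • X k ω := by
      intro ω
      have : c • X k ω = ∑ i : Fin N, if i = k then c • X i ω else 0 := by simp
      simp only [hB, hH]
      rw [this, ← Finset.sum_add_distrib]
      refine Finset.sum_congr rfl fun i _ => ?_
      rcases lt_trichotomy i k with h | h | h
      · have h' : i.val < k.val := h
        simp [h', h.ne, Nat.lt_succ_of_lt h']
      · subst h; simp
      · have h' : k.val < i.val := h
        have h1 : ¬ i.val < k.val + 1 := by omega
        have h2 : ¬ i.val < k.val := by omega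
        simp only [h1, h2, h.ne', if_false, add_zero]
    have e2 : ∀ ω, B k.val ω = H ω + (2 * c ^ 2) • A k ^ 2 := by
      intro ω
      have : (2 * c ^ 2) • A k ^ 2 = ∑ i : Fin N, if i = k then (2 * c ^ 2) • A i ^ 2 else 0 := by
        simp
      simp only [hB, hH]
      rw [this, ← Finset.sum_add_distrib]
      refine Finset.sum_congr rfl fun i _ => ?_
      by_cases h : i = k
      · subst h; simp
      · simp [h]
    obtain ⟨i1, i2⟩ := integral_mart (hFle k.castSucc) hHm hHb (hXint k) (hcond k)
    calc ∫ ω, trE (B (k.val + 1) ω) ∂μ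
        ≤ ∫ ω, (trE (B k.val ω) + c * rt (X k ω * NormedSpace.exp (H ω))) ∂μ := by
          refine integral_mono_ae (integrable_trE (hBm _) (hBb _))
            ((integrable_trE (hBm _) (hBb _)).add (i1.const_mul c)) ?_
          filter_upwards [ae_all_iff.2 hXherm, hdom k] with ω h1 h2
          have hHh : (H ω).IsHermitian := by
            refine isSelfAdjoint_sum _ fun i _ => ?_
            split_ifs
            · exact (h1 i).smul (IsSelfAdjoint.all c)
            · exact IsSelfAdjoint.zero _
            · exact ((hA i).pow 2).smul (IsSelfAdjoint.all _)
          rw [e1, e2]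
          exact trE_step hHh (h1 k) (hA k) c h2
      _ = _ := by
          rw [integral_add (integrable_trE (hBm _) (hBb _)) (i1.const_mul c),
            integral_const_mul, i2, mul_zero, add_zero]
  have hall : ∀ k : ℕ, k ≤ N → ∫ ω, trE (B k ω) ∂μ ≤ ∫ ω, trE (B 0 ω) ∂μ := by
    intro k
    induction k with
    | zero => intro _; exact le_rfl
    | succ k ih => intro hk; exact (hstep ⟨k, hk⟩).trans (ih (by omega))
  have hBN : ∀ ω, B N ω = c • ∑ i, X i ω := by
    intro ω
    simp [hB, Finset.smul_sum]
  have hB0 : ∀ ω, B 0 ω = (2 * c ^ 2) • ∑ i, A i ^ 2 := by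
    intro ω
    simp [hB, Finset.smul_sum]
  have hAh : (∑ i, A i ^ 2).IsHermitian := isSelfAdjoint_sum _ fun i _ => (hA i).pow 2
  have hfin : ∫ ω, trE (B N ω) ∂μ ≤ Fintype.card n * Real.exp (2 * c ^ 2 * σ2) := by
    refine (hall N le_rfl).trans ?_
    simp only [hB0, integral_const, probReal_univ, one_smul]
    rw [hσ2]
    exact trE_le_specNorm hAh (by positivity)
  have hsub : μ {ω | θ ≤ maxEig (∑ i, X i ω)} ≤ μ {ω | Real.exp (c * θ) ≤ trE (B N ω)} := by
    apply measure_mono_ae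
    filter_upwards [ae_all_iff.2 hXherm] with ω h1 h2
    have hh : (∑ i, X i ω).IsHermitian := isSelfAdjoint_sum _ fun i _ => h1 i
    change _ ≤ _
    rw [hBN]
    exact exp_maxEig_le hh hc0 h2
  have hnn : 0 ≤ᵐ[μ] fun ω => trE (B N ω) := by
    filter_upwards [ae_all_iff.2 hXherm] with ω h1
    have hh : (∑ i, X i ω).IsHermitian := isSelfAdjoint_sum _ fun i _ => h1 i
    have hh' : (B N ω).IsHermitian := by
      rw [hBN]; exact hh.smul (IsSelfAdjoint.all c)
    change 0 ≤ trE (B N ω)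
    rw [trE_eq_sum hh']
    exact Finset.sum_nonneg fun _ _ => (Real.exp_pos _).le
  have hmk := mul_meas_ge_le_integral_of_nonneg hnn (integrable_trE (hBm N) (hBb N))
    (Real.exp (c * θ))
  refine hsub.trans ?_
  rw [← ofReal_measureReal]
  apply ENNReal.ofReal_le_ofReal
  have h3 := hmk.trans hfin
  have h4 := mul_le_mul_of_nonneg_left h3 (Real.exp_pos (-(c * θ))).le
  rw [← mul_assoc, ← Real.exp_add, neg_add_cancel, Real.exp_zero, one_mul] at h4
  refine h4.trans (le_of_eq ?_)
  rw [mul_left_comm, ← Real.exp_add]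
  congr 2
  rw [hc]
  field_simp
  ring

end
end
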